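/- Let d be a positive integer, n ≥ 2, and let (X_j, Y_j, Δ_j), j = 1, …, n, be survival data with pairwise distinct observed times Y₁, …, Yₙ. Fix i ∈ {1,…,n}, a point θ̂ ∈ ℝᵈ, and an invertible d×d matrix A (playing the role of ∇²_θ𝓛_n(θ̂)/n). Define: the empirical score contribution ∇ℓ_n(θ̂; Z_i) := −Δ_i·( X_i − S_n^{(1)}(Y_i; θ̂)/S_n^{(0)}(Y_i; θ̂) ); the correction term C_i(θ̂) := exp(⟨θ̂, X_i⟩)·(1/n)·Σ_{j=1}^n 1[Y_i ≥ Y_j]·Δ_j/S_n^{(0)}(Y_j; θ̂)·( X_i − S_n^{(1)}(Y_j; θ̂)/S_n^{(0)}(Y_j; θ̂) ); the empirical influence function IF_n(i) := −A⁻¹·∇ℓ_n(θ̂; Z_i) − A⁻¹·C_i(θ̂); and the Versatile Influence Function VIF_n(i) := −A⁻¹·( ∇_θ𝓛_n(θ̂) − ∇_θ𝓛_{n−1}^{(-i)}(θ̂) ). Then the difference satisfies the exact algebraic identity VIF_n(i) − IF_n(i) = −A⁻¹ · ( exp(2·⟨θ̂, X_i⟩)/n ) · (1/n)·Σ_{j=1}^n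 1[Y_j ≤ Y_i]·Δ_j / ( S_n^{(0)}(Y_j; θ̂)·( S_n^{(0)}(Y_j; θ̂) − exp(⟨θ̂, X_i⟩)/n ) ) · ( X_i − S_n^{(1)}(Y_j; θ̂)/S_n^{(0)}(Y_j; θ̂) ) + A⁻¹ · ( exp(⟨θ̂, X_i⟩)/n ) · Δ_i / ( S_n^{(0)}(Y_i; θ̂) − exp(⟨θ̂, X_i⟩)/n ) · ( X_i − S_n^{(1)}(Y_i; θ̂)/S_n^{(0)}(Y_i; θ̂) ), provided S_n^{(0)}(Y_j; θ̂) − exp(⟨θ̂, X_i⟩)/n > 0 for every j with Y_j ≤ Y_i and Δ_j = 1 appearing in the sums. -/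

import Mathlib

open RealInnerProductSpace


lemma cox_aux_grad {ι E : Type*} [NormedAddCommGroup E] [InnerProductSpace ℝ E] [CompleteSpace E]
    (J : Finset ι) (K : Finset ι) (X : ι → E) (Y : ι → ℝ) (θ : E)
    (hpos : ∀ j ∈ J, 0 < ∑ k ∈ K, (if Y j ≤ Y k then Real.exp ⟪θ, X k⟫ else 0)) :
    gradient (fun θ => -∑ j ∈ J, (⟪θ, X j⟫ - Real.log
      (∑ k ∈ K, (if Y j ≤ Y k then Real.exp ⟪θ, X k⟫ else 0)))) θ
    = -∑ j ∈ J, (X j - (∑ k ∈ K, (if Y j ≤ Y k then Real.exp ⟪θ, X k⟫ else 0))⁻¹ •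
      ∑ k ∈ K, (if Y j ≤ Y k then Real.exp ⟪θ, X k⟫ • X k else 0)) := by
  apply HasGradientAt.gradient
  rw [hasGradientAt_iff_hasFDerivAt]
  have hin : ∀ x : E, HasFDerivAt (fun θ : E => ⟪θ, x⟫) (InnerProductSpace.toDual ℝ E x) θ := by
    intro x
    have h := (InnerProductSpace.toDual ℝ E x).hasFDerivAt (x := θ)
    refine h.congr_of_eventuallyEq (Filter.Eventually.of_forall fun y => ?_)
    simp [real_inner_comm]
  have hS : ∀ j, HasFDerivAt
      (fun θ : E => ∑ k ∈ K, (if Y j ≤ Y k then Real.exp ⟪θ, X k⟫ else 0))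
      (InnerProductSpace.toDual ℝ E
        (∑ k ∈ K, (if Y j ≤ Y k then Real.exp ⟪θ, X k⟫ • X k else 0))) θ := by
    intro j
    rw [map_sum]
    apply HasFDerivAt.fun_sum
    intro k _
    split_ifs
    · have := (hin (X k)).exp
      simpa using this
    · simpa using hasFDerivAt_const (0:ℝ) θ
  rw [map_neg, map_sum]
  apply HasFDerivAt.fun_neg
  apply HasFDerivAt.fun_sum
  intro j hj
  have := (hin (X j)).fun_sub ((hS j).log (hpos j hj).ne')
  simpa using this

lemma cox_aux_term {E : Type*} [AddCommGroup E] [Module ℝ E] (s ε : ℝ) (x t : E)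
    (hs : s ≠ 0) (hse : s - ε ≠ 0) :
    (s - ε)⁻¹ • (t - ε • x) = s⁻¹ • t - (ε * (s - ε)⁻¹) • (x - s⁻¹ • t) := by
  match_scalars <;> field_simp <;> ring

/-- For Cox regression with pairwise distinct observed times and an invertible
matrix `A` (playing the role of `∇²𝓛_n(θ̂)/n`), the difference between the Versatile Influence
Function `VIF_n(i) = −A⁻¹(∇𝓛_n(θ̂) − ∇𝓛_{n−1}^{(-i)}(θ̂))` and the empirical influence
function `IF_n(i) = −A⁻¹∇ℓ_n(θ̂; Z i) − A⁻¹ C_i(θ̂)` satisfies the exact algebraic identity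
stated in the paper, each term carrying an explicit factor `1/n`. -/
theorem cox_VIF_minus_IF_identity
    (d n : ℕ) (hd : 0 < d) (hn : 2 ≤ n)
    (X : Fin n → EuclideanSpace ℝ (Fin d)) (Y : Fin n → ℝ) (Δ : Fin n → Bool)
    (hY : Function.Injective Y) (i : Fin n)
    (θhat : EuclideanSpace ℝ (Fin d))
    (A : Matrix (Fin d) (Fin d) ℝ) (hA : IsUnit A)
    (S0 : ℝ → EuclideanSpace ℝ (Fin d) → ℝ)
    (hS0 : ∀ t θ, S0 t θ =
      (n : ℝ)⁻¹ * ∑ j : Fin n, (if t ≤ Y j then Real.exp ⟪θ, X j⟫ else 0))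
    (S1 : ℝ → EuclideanSpace ℝ (Fin d) → EuclideanSpace ℝ (Fin d))
    (hS1 : ∀ t θ, S1 t θ =
      (n : ℝ)⁻¹ • ∑ j : Fin n, (if t ≤ Y j then Real.exp ⟪θ, X j⟫ • X j else 0))
    (L : EuclideanSpace ℝ (Fin d) → ℝ)
    (hL : ∀ θ, L θ =
      -∑ j ∈ Finset.univ.filter (fun j => Δ j = true),
        (⟪θ, X j⟫ - Real.log
          (∑ k : Fin n, (if Y j ≤ Y k then Real.exp ⟪θ, X k⟫ else 0))))
    (Li : EuclideanSpace ℝ (Fin d) → ℝ)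
    (hLi : ∀ θ, Li θ =
      -∑ j ∈ Finset.univ.filter (fun j => j ≠ i ∧ Δ j = true),
        (⟪θ, X j⟫ - Real.log
          (∑ k ∈ Finset.univ.filter (fun k => k ≠ i),
            (if Y j ≤ Y k then Real.exp ⟪θ, X k⟫ else 0))))
    (gradli : EuclideanSpace ℝ (Fin d))
    (hgradli : gradli =
      -((if Δ i = true then (1 : ℝ) else 0) •
        (X i - (S0 (Y i) θhat)⁻¹ • S1 (Y i) θhat)))
    (Ci : EuclideanSpace ℝ (Fin d))
    (hCi : Ci = Real.exp ⟪θhat, X i⟫ •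
      ((n : ℝ)⁻¹ • ∑ j ∈ Finset.univ.filter (fun j => Y j ≤ Y i ∧ Δ j = true),
        (S0 (Y j) θhat)⁻¹ • (X i - (S0 (Y j) θhat)⁻¹ • S1 (Y j) θhat)))
    (IFn : EuclideanSpace ℝ (Fin d))
    (hIFn : IFn = -(Matrix.toEuclideanLin A⁻¹) gradli - (Matrix.toEuclideanLin A⁻¹) Ci)
    (VIFn : EuclideanSpace ℝ (Fin d))
    (hVIFn : VIFn = -(Matrix.toEuclideanLin A⁻¹) (gradient L θhat - gradient Li θhat))
    (hpos : ∀ j : Fin n, Y j ≤ Y i → Δ j = true →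
      0 < S0 (Y j) θhat - Real.exp ⟪θhat, X i⟫ / n) :
    VIFn - IFn =
      -(Matrix.toEuclideanLin A⁻¹)
          ((Real.exp (2 * ⟪θhat, X i⟫) / n) •
            ((n : ℝ)⁻¹ • ∑ j ∈ Finset.univ.filter (fun j => Y j ≤ Y i ∧ Δ j = true),
              (S0 (Y j) θhat * (S0 (Y j) θhat - Real.exp ⟪θhat, X i⟫ / n))⁻¹ •
                (X i - (S0 (Y j) θhat)⁻¹ • S1 (Y j) θhat)))
      + (Matrix.toEuclideanLin A⁻¹)
          ((Real.exp ⟪θhat, X i⟫ / n) •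
            ((if Δ i = true then (1 : ℝ) else 0) •
              ((S0 (Y i) θhat - Real.exp ⟪θhat, X i⟫ / n)⁻¹ •
                (X i - (S0 (Y i) θhat)⁻¹ • S1 (Y i) θhat)))) := by
  obtain rfl : L = _ := funext hL
  obtain rfl : Li = _ := funext hLi
  have hn0 : (n : ℝ) ≠ 0 := by positivity
  have hR : ∀ j, 0 < ∑ k : Fin n, (if Y j ≤ Y k then Real.exp ⟪θhat, X k⟫ else 0) := by
    intro j
    refine Finset.sum_pos' (fun k _ => by split_ifs <;> positivity) ⟨j, Finset.mem_univ _, ?_⟩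
    simp [Real.exp_pos]
  have hR' : ∀ j, j ≠ i → 0 < ∑ k ∈ Finset.univ.filter (fun k => k ≠ i),
      (if Y j ≤ Y k then Real.exp ⟪θhat, X k⟫ else 0) := by
    intro j hj
    refine Finset.sum_pos' (fun k _ => by split_ifs <;> positivity) ⟨j, by simp [hj], ?_⟩
    simp [Real.exp_pos]
  rw [cox_aux_grad _ _ _ _ _ (fun j _ => hR j),
    cox_aux_grad _ _ _ _ _ (fun j hj => hR' j (Finset.mem_filter.1 hj).2.1)] at hVIFn
  set e := Real.exp ⟪θhat, X i⟫ with he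
  have he2 : Real.exp (2 * ⟪θhat, X i⟫) = e * e := by
    rw [he, ← Real.exp_add]; congr 1; ring
  have hs0 : ∀ j, ∑ k : Fin n, (if Y j ≤ Y k then Real.exp ⟪θhat, X k⟫ else 0)
      = n * S0 (Y j) θhat := by
    intro j; rw [hS0]; field_simp
  have hs1 : ∀ j, ∑ k : Fin n, (if Y j ≤ Y k then Real.exp ⟪θhat, X k⟫ • X k else 0)
      = (n : ℝ) • S1 (Y j) θhat := by
    intro j; rw [hS1, smul_smul, mul_inv_cancel₀ hn0, one_smul]
  have hs0' : ∀ j, ∑ k ∈ Finset.univ.filter (fun k => k ≠ i),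
      (if Y j ≤ Y k then Real.exp ⟪θhat, X k⟫ else 0)
      = n * (S0 (Y j) θhat - if Y j ≤ Y i then e / n else 0) := by
    intro j
    rw [mul_sub, ← hs0, Finset.filter_ne', ← Finset.sum_erase_add _ _ (Finset.mem_univ i)]
    split_ifs <;> field_simp <;> simp [he]
  have hs1' : ∀ j, ∑ k ∈ Finset.univ.filter (fun k => k ≠ i),
      (if Y j ≤ Y k then Real.exp ⟪θhat, X k⟫ • X k else 0)
      = (n : ℝ) • (S1 (Y j) θhat - if Y j ≤ Y i then (e / n) • X i else 0) := by
    intro j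
    rw [smul_sub, ← hs1, Finset.filter_ne', ← Finset.sum_erase_add _ _ (Finset.mem_univ i)]
    split_ifs
    · rw [smul_smul, mul_div_cancel₀ _ hn0]; simp [he]
    · simp
  have hnpos : (0 : ℝ) < n := by positivity
  have hS0pos : ∀ j, 0 < S0 (Y j) θhat := by
    intro j
    have := hR j
    rw [hs0] at this
    exact pos_of_mul_pos_right this hnpos.le
  have hcan : ∀ (a : ℝ) (v : EuclideanSpace ℝ (Fin d)),
      ((n : ℝ) * a)⁻¹ • ((n : ℝ) • v) = a⁻¹ • v := by
    intro a v
    rw [smul_smul]; congr 1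
    rw [mul_inv]; field_simp
  simp only [hs0, hs1, hs0', hs1', hcan] at hVIFn
  set v : Fin n → EuclideanSpace ℝ (Fin d) :=
    fun j => X i - (S0 (Y j) θhat)⁻¹ • S1 (Y j) θhat with hv
  have hterm : ∀ j, Δ j = true →
      (S0 (Y j) θhat - if Y j ≤ Y i then e / n else 0)⁻¹ •
        (S1 (Y j) θhat - if Y j ≤ Y i then (e / n) • X i else 0)
      = (S0 (Y j) θhat)⁻¹ • S1 (Y j) θhat
        - if Y j ≤ Y i then ((e / n) * (S0 (Y j) θhat - e / n)⁻¹) • v j else 0 := by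
    intro j hj
    split_ifs with h
    · exact cox_aux_term _ _ _ _ (hS0pos j).ne' (hpos j h hj).ne'
    · simp
  have key : ∀ F G : Fin n → EuclideanSpace ℝ (Fin d),
      (∑ j ∈ Finset.univ.filter (fun j => Δ j = true), F j)
      - ∑ j ∈ Finset.univ.filter (fun j => j ≠ i ∧ Δ j = true), (F j + G j)
      = (if Δ i = true then (1:ℝ) else 0) • (F i + G i)
        - ∑ j ∈ Finset.univ.filter (fun j => Δ j = true), G j := by
    intro F G
    have : ∀ H : Fin n → EuclideanSpace ℝ (Fin d),
        ∑ j ∈ Finset.univ.filter (fun j => Δ j = true), H j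
        = (if Δ i = true then (1:ℝ) else 0) • H i
          + ∑ j ∈ Finset.univ.filter (fun j => j ≠ i ∧ Δ j = true), H j := by
      intro H
      rw [Finset.sum_filter, Finset.sum_filter, ← Finset.add_sum_erase _ _ (Finset.mem_univ i),
        ← Finset.filter_ne', Finset.sum_filter]
      congr 1
      · split_ifs <;> simp
      · refine Finset.sum_congr rfl fun j _ => ?_
        by_cases h : j = i <;> simp [h]
    rw [this F, this G, Finset.sum_add_distrib]
    module
  have hgrad : (-∑ j ∈ Finset.univ.filter (fun j => Δ j = true),
        (X j - (S0 (Y j) θhat)⁻¹ • S1 (Y j) θhat))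
      - (-∑ j ∈ Finset.univ.filter (fun j => j ≠ i ∧ Δ j = true),
        (X j - (S0 (Y j) θhat - if Y j ≤ Y i then e / n else 0)⁻¹ •
        (S1 (Y j) θhat - if Y j ≤ Y i then (e / n) • X i else 0)))
      = gradli - (if Δ i = true then (1:ℝ) else 0) • ((e / n) * (S0 (Y i) θhat - e / n)⁻¹) • v i
        + ∑ j ∈ Finset.univ.filter (fun j => Y j ≤ Y i ∧ Δ j = true),
          ((e / n) * (S0 (Y j) θhat - e / n)⁻¹) • v j := by
    have h1 : ∑ j ∈ Finset.univ.filter (fun j => j ≠ i ∧ Δ j = true),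
        (X j - (S0 (Y j) θhat - if Y j ≤ Y i then e / n else 0)⁻¹ •
        (S1 (Y j) θhat - if Y j ≤ Y i then (e / n) • X i else 0))
        = ∑ j ∈ Finset.univ.filter (fun j => j ≠ i ∧ Δ j = true),
        ((X j - (S0 (Y j) θhat)⁻¹ • S1 (Y j) θhat) +
         if Y j ≤ Y i then ((e / n) * (S0 (Y j) θhat - e / n)⁻¹) • v j else 0) := by
      refine Finset.sum_congr rfl fun j hj => ?_
      rw [hterm j (Finset.mem_filter.1 hj).2.2]
      abel
    have h2 : ∑ j ∈ Finset.univ.filter (fun j => Y j ≤ Y i ∧ Δ j = true),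
          ((e / n) * (S0 (Y j) θhat - e / n)⁻¹) • v j
        = ∑ j ∈ Finset.univ.filter (fun j => Δ j = true),
          if Y j ≤ Y i then ((e / n) * (S0 (Y j) θhat - e / n)⁻¹) • v j else 0 := by
      rw [← Finset.sum_filter, Finset.filter_filter]
      simp only [and_comm]
    rw [h1, h2, ← neg_sub', key, hgradli, if_pos le_rfl]
    simp only [hv]
    module
  rw [hgrad] at hVIFn
  have hsum : ∑ j ∈ Finset.univ.filter (fun j => Y j ≤ Y i ∧ Δ j = true),
          ((e / n) * (S0 (Y j) θhat - e / n)⁻¹) • v j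
      = Ci + (e * e / n) • ((n : ℝ)⁻¹ •
        ∑ j ∈ Finset.univ.filter (fun j => Y j ≤ Y i ∧ Δ j = true),
              (S0 (Y j) θhat * (S0 (Y j) θhat - e / n))⁻¹ • v j) := by
    rw [hCi]
    simp only [Finset.smul_sum]
    rw [← Finset.sum_add_distrib]
    refine Finset.sum_congr rfl fun j hj => ?_
    obtain ⟨h, h'⟩ := (Finset.mem_filter.1 hj).2
    have a := (hS0pos j).ne'
    have b := (hpos j h h').ne'
    change _ = e • (n : ℝ)⁻¹ • (S0 (Y j) θhat)⁻¹ • v j + _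
    simp only [smul_smul, ← add_smul]
    congr 1
    generalize S0 (Y j) θhat = s at a b
    have b' : n * s - e ≠ 0 := by
      intro h0; apply b; field_simp; linarith
    have c : s - e / n = (n * s - e) / n := by field_simp
    rw [c]
    field_simp
    ring
  rw [hsum] at hVIFn
  rw [hVIFn, hIFn, he2]
  change _ = -(Matrix.toEuclideanLin A⁻¹) ((e * e / n) • ((n : ℝ)⁻¹ •
        ∑ j ∈ Finset.univ.filter (fun j => Y j ≤ Y i ∧ Δ j = true),
              (S0 (Y j) θhat * (S0 (Y j) θhat - e / n))⁻¹ • v j))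
    + (Matrix.toEuclideanLin A⁻¹) ((e / n) • ((if Δ i = true then (1 : ℝ) else 0) •
      ((S0 (Y i) θhat - e / n)⁻¹ • v i)))
  simp only [map_add, map_sub, map_smul]
  module
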